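/- arXiv:2307.06311 — 8 statements merged into one kernel-verified Lean document; each statement's English description precedes it below -/
import Mathlib

section
/- Let n ≥ 1 be an integer. Work in the commutative ring P = MvPolynomial over ℝ with variables a_{{i,j}} and b_{{i,j}} indexed by unordered pairs {i,j} from {1,…,n} (allowing i = j). Let A and B be the n×n matrices over P with A i j = a_{{i,j}} and B i j = b_{{i,j}} (so A and B are symmetric). View trace((A.map C + X • B.map C)^6) as a univariate polynomial in X over P. Then its coefficient of X² is a sum of squares in P: there is a finite family of polynomials q₁,…,q_m ∈ P with coeff₂ = q₁² + ⋯ + q_m². -/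
open Matrix

/-- The polynomial ring P over ℝ with variables a_{{i,j}} (left) and b_{{i,j}} (right),
indexed by unordered pairs from {1,…,n} (allowing i = j). -/
abbrev P (n : ℕ) := MvPolynomial (Sym2 (Fin n) ⊕ Sym2 (Fin n)) ℝ

/-- The symmetric matrix A with A i j = a_{{i,j}}. -/
noncomputable def Amat (n : ℕ) : Matrix (Fin n) (Fin n) (P n) :=
  Matrix.of fun i j => MvPolynomial.X (Sum.inl s(i, j))

/-- The symmetric matrix B with B i j = b_{{i,j}}. -/
noncomputable def Bmat (n : ℕ) : Matrix (Fin n) (Fin n) (P n) :=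
  Matrix.of fun i j => MvPolynomial.X (Sum.inr s(i, j))

lemma coeff_two_words {R : Type*} [Ring R] (a b : R) :
    ((Polynomial.C a + Polynomial.C b * Polynomial.X) ^ 6 : Polynomial R).coeff 2 =
      b*b*a*a*a*a + b*a*b*a*a*a + b*a*a*b*a*a + b*a*a*a*b*a + b*a*a*a*a*b
      + a*b*b*a*a*a + a*b*a*b*a*a + a*b*a*a*b*a + a*b*a*a*a*b
      + a*a*b*b*a*a + a*a*b*a*b*a + a*a*b*a*a*b
      + a*a*a*b*b*a + a*a*a*b*a*b + a*a*a*a*b*b := by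
  have h1 : ∀ (p : Polynomial R) (k : ℕ),
      (p * (Polynomial.C a + Polynomial.C b * Polynomial.X)).coeff (k+1)
        = p.coeff (k+1) * a + p.coeff k * b := by
    intro p k
    rw [mul_add, ← mul_assoc, Polynomial.coeff_add, Polynomial.coeff_mul_X,
      Polynomial.coeff_mul_C, Polynomial.coeff_mul_C]
  have h0 : ∀ (p : Polynomial R),
      (p * (Polynomial.C a + Polynomial.C b * Polynomial.X)).coeff 0 = p.coeff 0 * a := by
    intro p
    simp [mul_add, ← mul_assoc]
  have h2 : ∀ p : Polynomial R,
      (p * (Polynomial.C a + Polynomial.C b * Polynomial.X)).coeff 2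
        = p.coeff 2 * a + p.coeff 1 * b := fun p => h1 p 1
  have h3 : ∀ p : Polynomial R,
      (p * (Polynomial.C a + Polynomial.C b * Polynomial.X)).coeff 1
        = p.coeff 1 * a + p.coeff 0 * b := fun p => h1 p 0
  have e : ∀ y : Polynomial R, y ^ 6 = 1 * y * y * y * y * y * y := by
    intro y; simp only [pow_succ, pow_zero]
  rw [e]
  simp only [h2, h3, h0, Polynomial.coeff_one]
  norm_num
  noncomm_ring

lemma trace_words {n : ℕ} {S : Type*} [CommRing S] (A B : Matrix (Fin n) (Fin n) S) :
    (Matrix.trace ((A.map Polynomial.C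
        + (Polynomial.X : Polynomial S) • B.map Polynomial.C) ^ 6)).coeff 2
      = 6 * trace (A*A*A*A*B*B) + 6 * trace (A*A*A*B*A*B) + 3 * trace (A*A*B*A*A*B) := by
  have h : (Matrix.trace ((A.map Polynomial.C
        + (Polynomial.X : Polynomial S) • B.map Polynomial.C) ^ 6)).coeff 2
      = trace (((Polynomial.C A + Polynomial.C B * Polynomial.X) ^ 6 :
          Polynomial (Matrix (Fin n) (Fin n) S)).coeff 2) := by
    have e : matPolyEquiv (A.map Polynomial.C + (Polynomial.X : Polynomial S) • B.map Polynomial.C)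
        = Polynomial.C A + Polynomial.C B * Polynomial.X := by
      rw [map_add, matPolyEquiv_map_C, matPolyEquiv_map_smul, matPolyEquiv_map_C]
      simp [Polynomial.X_mul_C]
    rw [← e, ← map_pow]
    simp only [Matrix.trace, Matrix.diag_apply, matPolyEquiv_coeff_apply, Polynomial.finsetSum_coeff]
  have c : ∀ U V : Matrix (Fin n) (Fin n) S, trace (U * V) = trace (V * U) :=
    fun U V => trace_mul_comm U V
  rw [h, coeff_two_words]
  simp only [trace_add]
  have w1 := c (B*B) (A*A*A*A)
  have w2 := c (B*A*B) (A*A*A)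
  have w2' := c (A*A*A*B) (A*B)
  have w3 := c (B*A*A*B) (A*A)
  have w3' := c (A*A*B) (B*A*A)
  have w4 := c (B*A) (A*A*B*A)
  have w4 := c B (A*A*A*B*A)
  have w5 := c B (A*A*A*A*B)
  have w6 := c (A*B*B) (A*A*A)
  have w7 := c (A*B*A*B) (A*A)
  have w8 := c (A*B) (A*A*B*A)
  have w8' := c A (B*A*A*B*A)
  have w8'' := c B (A*A*B*A*A)
  have w9 := c (A*B) (A*A*A*B)
  have w10 := c (A*A*B*B) (A*A)
  have w11 := c (A*A*B*A*B) A
  have w13 := c (A*A*A*B*B) A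
  simp only [← mul_assoc] at *
  linear_combination w1 + w2 + w8'' + w4 + w5 + w6 + w7 + w8' + w8'' + w9 + w10 + w11 + w13

lemma norm_words {n : ℕ} {S : Type*} [CommRing S] (A B : Matrix (Fin n) (Fin n) S)
    (hA : Aᵀ = A) (hB : Bᵀ = B) (r : S) (hr : 2 * r = 1) :
    6 * trace (A*A*A*A*B*B) + 6 * trace (A*A*A*B*A*B) + 3 * trace (A*A*B*A*A*B)
      = 6 * (∑ p : Fin n × Fin n, ((A*A*B + r • (A*B*A)) p.1 p.2) ^ 2)
        + 3 * r * (∑ p : Fin n × Fin n, ((A*B*A) p.1 p.2) ^ 2) := by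
  have hs : ∀ M : Matrix (Fin n) (Fin n) S,
      (∑ p : Fin n × Fin n, (M p.1 p.2) ^ 2) = trace (M * Mᵀ) := by
    intro M
    simp [Fintype.sum_prod_type, Matrix.trace, Matrix.mul_apply, sq]
  rw [hs, hs]
  simp only [transpose_add, transpose_smul, transpose_mul, hA, hB, mul_add, add_mul,
    smul_mul_assoc, mul_smul_comm, trace_add, trace_smul, smul_eq_mul]
  have c : ∀ U V : Matrix (Fin n) (Fin n) S, trace (U * V) = trace (V * U) :=
    fun U V => trace_mul_comm U V
  have w1 := c (A*A*B*B) (A*A)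
  have w2 := c (A*A*B*A*B) A
  have w3 := c (A*B*A*B) (A*A)
  have w4 := c (A*B*A*A*B) A
  simp only [← mul_assoc] at *
  rw [w1, w2, w3, w4]
  linear_combination (- 6 * trace (A*A*A*B*A*B) - 3 * (r + 1) * trace (A*A*B*A*A*B)) * hr

/-- the coefficient of X² in trace((A + X·B)^6), viewed as a univariate
polynomial over P, is a sum of squares in P. -/
theorem coeff_two_trace_pow_six_is_sum_of_squares (n : ℕ) (hn : 1 ≤ n) :
    ∃ (m : ℕ) (q : Fin m → P n),
      (Matrix.trace (((Amat n).map Polynomial.C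
          + (Polynomial.X : Polynomial (P n)) • (Bmat n).map Polynomial.C) ^ 6)).coeff 2
        = ∑ i, q i ^ 2 := by
  have hA : (Amat n)ᵀ = Amat n := by
    ext1 i j; simp [Amat, Sym2.eq_swap]
  have hB : (Bmat n)ᵀ = Bmat n := by
    ext1 i j; simp [Bmat, Sym2.eq_swap]
  have hc : ∀ x : ℝ, 0 ≤ x →
      (MvPolynomial.C (√x) : P n) ^ 2 = MvPolynomial.C x := by
    intro x hx
    rw [← map_pow, Real.sq_sqrt hx]
  have hr : (2 : P n) * MvPolynomial.C (1/2 : ℝ) = 1 := by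
    rw [← map_ofNat (MvPolynomial.C : ℝ →+* P n) 2, ← map_mul]
    norm_num
  rw [trace_words, norm_words _ _ hA hB _ hr]
  let ι := (Fin n × Fin n) ⊕ (Fin n × Fin n)
  let f : ι → P n := Sum.elim
    (fun p => MvPolynomial.C (√6) * ((Amat n * Amat n * Bmat n
      + (MvPolynomial.C (1/2 : ℝ) : P n) • (Amat n * Bmat n * Amat n)) p.1 p.2))
    (fun p => MvPolynomial.C (√(3 * (1/2))) * ((Amat n * Bmat n * Amat n) p.1 p.2))
  refine ⟨Fintype.card ι, fun i => f ((Fintype.equivFin ι).symm i), ?_⟩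
  rw [Equiv.sum_comp (Fintype.equivFin ι).symm (fun i => f i ^ 2), Fintype.sum_sum_type]
  simp only [f, Sum.elim_inl, Sum.elim_inr, mul_pow]
  rw [hc 6 (by norm_num), hc (3 * (1/2)) (by norm_num), ← Finset.mul_sum, ← Finset.mul_sum,
    map_mul, map_ofNat, map_ofNat]
end

section
/- Let n ≥ 1 be an integer and let A and B be n×n real symmetric matrices. View trace((A.map C + X • B.map C)^6) as a univariate real polynomial in X (where C : ℝ → ℝ[X] is the constant embedding). Then the coefficient of X² in this polynomial is nonnegative. -/
open Matrix

theorem aux_coeff {R : Type*} [Ring R] (a b : R) :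
    ((Polynomial.C a + Polynomial.C b * Polynomial.X) ^ 6).coeff 2
      = (a*a*a)*(a*b*b+b*a*b+b*b*a) + (a*a*b+a*b*a+b*a*a)*(a*a*b+a*b*a+b*a*a)
        + (a*b*b+b*a*b+b*b*a)*(a*a*a) := by
  have h0 : (Polynomial.C a + Polynomial.C b * Polynomial.X).coeff 0 = a := by simp
  have h1 : (Polynomial.C a + Polynomial.C b * Polynomial.X).coeff 1 = b := by
    simp [Polynomial.coeff_C]
  have h2 : (Polynomial.C a + Polynomial.C b * Polynomial.X).coeff 2 = 0 := by
    simp [Polynomial.coeff_C, Polynomial.coeff_X]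
  generalize (Polynomial.C a + Polynomial.C b * Polynomial.X) = p at *
  have e : p ^ 6 = (p*p*p)*(p*p*p) := by noncomm_ring
  rw [e]
  have m1 : ∀ p q : Polynomial R, (p*q).coeff 1 = p.coeff 0 * q.coeff 1 + p.coeff 1 * q.coeff 0 := by
    intro p q
    rw [Polynomial.coeff_mul, Finset.Nat.sum_antidiagonal_eq_sum_range_succ_mk]
    simp [Finset.sum_range_succ]
  have m2 : ∀ p q : Polynomial R, (p*q).coeff 2
      = p.coeff 0 * q.coeff 2 + p.coeff 1 * q.coeff 1 + p.coeff 2 * q.coeff 0 := by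
    intro p q
    rw [Polynomial.coeff_mul, Finset.Nat.sum_antidiagonal_eq_sum_range_succ_mk]
    simp [Finset.sum_range_succ]
  simp only [m1, m2, Polynomial.mul_coeff_zero, h0, h1, h2]
  noncomm_ring

theorem aux_trace {n : ℕ} (M : Matrix (Fin n) (Fin n) ℝ) : 0 ≤ trace (M * Mᵀ) := by
  simp only [trace, diag, mul_apply, transpose_apply]
  exact Finset.sum_nonneg fun i _ => Finset.sum_nonneg fun j _ => mul_self_nonneg _

/-- for n×n real symmetric matrices A, B, the coefficient of X² in
trace((A + X·B)^6) (a univariate real polynomial) is nonnegative. -/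
theorem coeff_two_trace_pow_six_nonneg (n : ℕ) (hn : 1 ≤ n)
    (A B : Matrix (Fin n) (Fin n) ℝ) (hA : A.IsSymm) (hB : B.IsSymm) :
    0 ≤ (Matrix.trace ((A.map Polynomial.C
        + (Polynomial.X : Polynomial ℝ) • B.map Polynomial.C) ^ 6)).coeff 2 := by
  have key : (Matrix.trace ((A.map Polynomial.C
        + (Polynomial.X : Polynomial ℝ) • B.map Polynomial.C) ^ 6)).coeff 2
      = trace (((Polynomial.C A + Polynomial.C B * Polynomial.X) ^ 6).coeff 2) := by
    have h : matPolyEquiv (A.map Polynomial.C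
        + (Polynomial.X : Polynomial ℝ) • B.map Polynomial.C)
        = Polynomial.C A + Polynomial.C B * Polynomial.X := by
      rw [map_add, matPolyEquiv_map_C, matPolyEquiv_map_smul, matPolyEquiv_map_C]
      simp [Polynomial.X_mul_C]
    rw [← h, ← map_pow]
    simp only [trace, diag, Polynomial.finsetSum_coeff, matPolyEquiv_coeff_apply]
  rw [key, aux_coeff]
  have h1 := aux_trace (A*A*B + A*A*B + A*B*A)
  have h2 := aux_trace (A*B*A)
  simp only [transpose_add, transpose_mul, hA.eq, hB.eq] at h1 h2
  have cyc : ∀ a b c d e f : Matrix (Fin n) (Fin n) ℝ,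
      trace (a*(b*(c*(d*(e*f))))) = trace (b*(c*(d*(e*(f*a))))) := by
    intro a b c d e f
    rw [trace_mul_comm]; simp only [Matrix.mul_assoc]
  simp only [mul_add, add_mul, Matrix.mul_assoc, trace_add] at h1 h2 ⊢
  linarith [cyc A A A A B B, cyc A A A B B A, cyc A A B B A A, cyc A B B A A A, cyc B B A A A A,
    cyc B A A A A B, cyc A A A B A B, cyc A A B A B A, cyc A B A B A A, cyc B A B A A A,
    cyc A B A A A B, cyc B A A A B A, cyc A A B A A B, cyc A B A A B A, cyc B A A B A A]
end

section
/- Let n ≥ 2 be an integer. Let F be the n² × n² real matrix partitioned into four consecutive row and column blocks of sizes 1, n−1, n−1, (n−1)², constant on each block, with block value matrix [[30,21,21,12],[21,18,12,9],[21,12,18,9],[12,9,9,6]]; let E⁺ and G be as follows: E⁺ is the 2n(n−1) × 2n(n−1) real matrix consisting of two diagonal blocks of size n(n−1) with every entry equal to 1/(6n²(n−1)²) and off-diagonal blocks equal to zero, and G is the 2n(n−1) × n² real matrix whose rows are partitioned into two consecutive blocks of size n(n−1) and whose columns into four consecutive blocks of sizes 1, n−1, n−1, (n−1)², constant on each block,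 with block values (9, 3, 9, 3) for the first row block and (9, 9, 3, 3) for the second row block. Then the generalized Schur complement F − Gᵀ·E⁺·G equals the n² × n² matrix with every entry equal to 3, and in particular F − Gᵀ·E⁺·G is positive semidefinite. -/
open Matrix

/-- Row index set for E and G: two consecutive blocks of size n(n−1). -/
abbrev RowEG (n : ℕ) := Fin (n * (n - 1)) ⊕ Fin (n * (n - 1))

/-- Column index set for G and F: four consecutive blocks of sizes 1, n−1, n−1, (n−1)². -/
abbrev ColG (n : ℕ) := Fin 1 ⊕ Fin (n - 1) ⊕ Fin (n - 1) ⊕ Fin ((n - 1) * (n - 1))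

/-- The matrix E: two diagonal blocks of size n(n−1) with every entry 6, zero elsewhere. -/
noncomputable def Emat (n : ℕ) : Matrix (RowEG n) (RowEG n) ℝ :=
  Matrix.of fun i j =>
    match i, j with
    | .inl _, .inl _ => 6
    | .inr _, .inr _ => 6
    | _, _ => 0

/-- The matrix E⁺: two diagonal blocks of size n(n−1) with every entry 1/(6n²(n−1)²),
zero elsewhere. -/
noncomputable def Epmat (n : ℕ) : Matrix (RowEG n) (RowEG n) ℝ :=
  Matrix.of fun i j =>
    match i, j with
    | .inl _, .inl _ => 1 / (6 * (n : ℝ) ^ 2 * ((n : ℝ) - 1) ^ 2)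
    | .inr _, .inr _ => 1 / (6 * (n : ℝ) ^ 2 * ((n : ℝ) - 1) ^ 2)
    | _, _ => 0

/-- The matrix G: block constant, with block values (9, 3, 9, 3) on the first row block
and (9, 9, 3, 3) on the second row block. -/
noncomputable def Gmat (n : ℕ) : Matrix (RowEG n) (ColG n) ℝ :=
  Matrix.of fun i j =>
    match i, j with
    | .inl _, .inl _ => 9
    | .inl _, .inr (.inl _) => 3
    | .inl _, .inr (.inr (.inl _)) => 9
    | .inl _, .inr (.inr (.inr _)) => 3
    | .inr _, .inl _ => 9
    | .inr _, .inr (.inl _) => 9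
    | .inr _, .inr (.inr (.inl _)) => 3
    | .inr _, .inr (.inr (.inr _)) => 3

/-- The block index (in Fin 4) of a column index of G. -/
def colBlk {n : ℕ} : ColG n → Fin 4
  | .inl _ => 0
  | .inr (.inl _) => 1
  | .inr (.inr (.inl _)) => 2
  | .inr (.inr (.inr _)) => 3

/-- The matrix F: block constant on the four blocks of sizes 1, n−1, n−1, (n−1)² with block
value matrix [[30,21,21,12],[21,18,12,9],[21,12,18,9],[12,9,9,6]]. -/
noncomputable def Fmat (n : ℕ) : Matrix (ColG n) (ColG n) ℝ :=
  Matrix.of fun i j =>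
    (!![30, 21, 21, 12; 21, 18, 12, 9; 21, 12, 18, 9; 12, 9, 9, 6] : Matrix (Fin 4) (Fin 4) ℝ)
      (colBlk i) (colBlk j)

set_option maxHeartbeats 4000000 in
theorem schur_key (n : ℕ) (hn : 2 ≤ n) :
    Fmat n - (Gmat n)ᵀ * Epmat n * Gmat n = Matrix.of (fun _ _ : ColG n => (3 : ℝ)) := by
  have h2 : (2:ℝ) ≤ n := by exact_mod_cast hn
  have h0 : (n:ℝ) ≠ 0 := by linarith
  have h1 : (n:ℝ) - 1 ≠ 0 := by linarith
  have hc : ((n - 1 : ℕ) : ℝ) = (n:ℝ) - 1 := by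
    rw [Nat.cast_sub (by omega)]; simp
  have key : Fmat n - (Gmat n)ᵀ * Epmat n * Gmat n
      = Matrix.of (fun _ _ : ColG n => (3 : ℝ)) := by
    ext i j
    rcases i with i | i | i | i <;> rcases j with j | j | j | j <;>
    · simp [Fmat, Gmat, Epmat, colBlk, Matrix.mul_apply, Fintype.sum_sum_type, hc]
      field_simp
      norm_num
  exact key

/-- the generalized Schur complement F − Gᵀ·E⁺·G is the all-3 matrix of size
n² = 1 + 2(n−1) + (n−1)², and in particular it is positive semidefinite. -/
theorem schur_complement_eq_and_posSemidef (n : ℕ) (hn : 2 ≤ n) :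
    Fmat n - (Gmat n)ᵀ * Epmat n * Gmat n = Matrix.of (fun _ _ : ColG n => (3 : ℝ)) ∧
    (Fmat n - (Gmat n)ᵀ * Epmat n * Gmat n).PosSemidef := by
  have key := schur_key n hn
  refine ⟨key, ?_⟩
  rw [key]
  have h3 : Matrix.of (fun _ _ : ColG n => (3 : ℝ))
      = (3:ℝ) • Matrix.vecMulVec (fun _ : ColG n => (1:ℝ)) (star (fun _ : ColG n => (1:ℝ))) := by
    ext i j
    simp [Matrix.vecMulVec_apply]
  rw [h3]
  exact (Matrix.posSemidef_vecMulVec_self_star _).smul (by norm_num)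
end

section
/- Let n ≥ 4 be an integer. Let R be the (3n²−2n) × (3n²−2n) real matrix whose rows and columns are partitioned into six consecutive blocks of sizes 1, n−1, n−1, (n−1)², n(n−1), n(n−1), which is constant on each block, the constant on block (p,q) being the (p,q) entry of the 6×6 matrix [[30,21,21,12,9,9],[21,18,12,9,3,9],[21,12,18,9,9,3],[12,9,9,6,3,3],[9,3,9,3,6,0],[9,9,3,3,0,6]]. Then R is positive semidefinite. -/
open Matrix

/-- Index set for the matrix R: six consecutive blocks of sizes
1, n−1, n−1, (n−1)², n(n−1), n(n−1). -/
abbrev IdxR (n : ℕ) :=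
  Fin 1 ⊕ Fin (n - 1) ⊕ Fin (n - 1) ⊕ Fin ((n - 1) * (n - 1))
    ⊕ Fin (n * (n - 1)) ⊕ Fin (n * (n - 1))

/-- The block index (in Fin 6) of an index of R. -/
def blkR {n : ℕ} : IdxR n → Fin 6
  | .inl _ => 0
  | .inr (.inl _) => 1
  | .inr (.inr (.inl _)) => 2
  | .inr (.inr (.inr (.inl _))) => 3
  | .inr (.inr (.inr (.inr (.inl _)))) => 4
  | .inr (.inr (.inr (.inr (.inr _)))) => 5

/-- The matrix R of the paper: block constant, with block values given by the 6×6 table. -/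
noncomputable def Rmat (n : ℕ) : Matrix (IdxR n) (IdxR n) ℝ :=
  Matrix.of fun i j =>
    (!![30, 21, 21, 12, 9, 9;
        21, 18, 12, 9, 3, 9;
        21, 12, 18, 9, 9, 3;
        12, 9, 9, 6, 3, 3;
        9, 3, 9, 3, 6, 0;
        9, 9, 3, 3, 0, 6] : Matrix (Fin 6) (Fin 6) ℝ) (blkR i) (blkR j)

/-- R is positive semidefinite. -/
theorem Rmat_posSemidef (n : ℕ) (hn : 4 ≤ n) : (Rmat n).PosSemidef := by
  have key : ∀ v : IdxR n → ℝ, (Matrix.vecMulVec v v).PosSemidef := fun v => by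
    simpa using Matrix.posSemidef_vecMulVec_self_star v
  have h := (((key fun i => (![1, 1, 1, 1, 0, 0] : Fin 6 → ℝ) (blkR i)).add
    (key fun i => (![3, 2, 2, 1, 1, 1] : Fin 6 → ℝ) (blkR i))).add
    (key fun i => (![0, 1, -1, 0, -1, 1] : Fin 6 → ℝ) (blkR i))).smul
    (show (0 : ℝ) ≤ 3 by norm_num)
  convert h using 1
  ext i j
  simp only [Rmat, Matrix.of_apply, Matrix.smul_apply, Matrix.add_apply,
    Matrix.vecMulVec_apply, smul_eq_mul]
  generalize blkR i = a
  generalize blkR j = b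
  fin_cases a <;> fin_cases b <;> norm_num [Matrix.of_apply, Matrix.cons_val]
end

section
/- Fix an integer n ≥ 4 and set f = −42n² + 24n, g = 378n⁴ − 477n³ + 144n², and h = −540n⁶ + 1080n⁵ − 675n⁴ + 135n³. Let U be the real symmetric matrix defined as follows. Its index set is I₁ ⊔ I₂ ⊔ I₃, where I₁ = {(T,ℓ) : T a 3-element subset of {1,…,n}, ℓ ∈ T}, I₂ = {(i,j) : i,j ∈ {1,…,n}, i ≠ j}, and I₃ = {1,…,n} × {1,…,n} with elements written (î,ĵ). Using Iverson brackets [P] ∈ {0,1}, the entries of U are: for (T,ℓ), (T′,ℓ′) ∈ I₁: 6(|T ∩ T′| + [ℓ = ℓ′]); for (i,j), (i′,j′) ∈ I₂: 6[j = j′] + 30[i = i′] + 12[i = j′] + 12[j = i′]; for (î,ĵ), (î′,ĵ′) ∈ I₃: 3(|{î,ĵ} ∩ {î′,ĵ′}| + [î = î′]) if î ≠ ĵ and î′ ≠ ĵ′, and 3(3[î = î′] + 2[ĵ = ĵ′]) if î = ĵ or î′ = ĵ′; for (T,ℓ) ∈ I₁ and (i′,j′) ∈ I₂: 12[i′ ∈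 T] + 6[j′ ∈ T] + 6[i′ = ℓ]; for (T,ℓ) ∈ I₁ and (î,ĵ) ∈ I₃: 6[î ∈ T] + 3[ĵ ∈ T] + 3[ĵ = ℓ]; for (i,j) ∈ I₂ and (î,ĵ) ∈ I₃: 15 if i = î and j = ĵ; otherwise 21 if i = î and i = ĵ; otherwise 12 if i = î and j ≠ î and i ≠ ĵ; otherwise 15 if j = î and i = ĵ; otherwise 9 if i = ĵ and j ≠ î and i ≠ î; otherwise 9 if î = ĵ and j = î; otherwise 6 if j = î and i ≠ ĵ and j ≠ ĵ; otherwise 3 if j = ĵ and î ≠ ĵ; otherwise 0; and the entries with row index in a later block than the column index are given by symmetry. Then U⁴ + f·U³ + g·U² + h·U = 0. -/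
open Matrix

/-- Iverson bracket. -/
noncomputable def iv (P : Prop) [Decidable P] : ℝ := if P then 1 else 0

/-- Index block 1: pairs (T, ℓ) with T a 3-element subset and ℓ ∈ T. -/
abbrev I1 (n : ℕ) := {p : Finset (Fin n) × Fin n // p.1.card = 3 ∧ p.2 ∈ p.1}
/-- Index block 2: pairs (i, j) with i ≠ j. -/
abbrev I2 (n : ℕ) := {p : Fin n × Fin n // p.1 ≠ p.2}
/-- Index block 3: all pairs (î, ĵ). -/
abbrev I3 (n : ℕ) := Fin n × Fin n
/-- Full index set of the matrix U. -/
abbrev Idx (n : ℕ) := I1 n ⊕ I2 n ⊕ I3 n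

noncomputable def u11 {n : ℕ} (T : Finset (Fin n)) (l : Fin n) (T' : Finset (Fin n)) (l' : Fin n) : ℝ :=
  6 * (((T ∩ T').card : ℝ) + iv (l = l'))

noncomputable def u22 {n : ℕ} (i j i' j' : Fin n) : ℝ :=
  6 * iv (j = j') + 30 * iv (i = i') + 12 * iv (i = j') + 12 * iv (j = i')

noncomputable def u33 {n : ℕ} (i j i' j' : Fin n) : ℝ :=
  if i ≠ j ∧ i' ≠ j' then
    3 * (((({i, j} : Finset (Fin n)) ∩ ({i', j'} : Finset (Fin n))).card : ℝ) + iv (i = i'))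
  else
    3 * (3 * iv (i = i') + 2 * iv (j = j'))

noncomputable def u12 {n : ℕ} (T : Finset (Fin n)) (l : Fin n) (i' j' : Fin n) : ℝ :=
  12 * iv (i' ∈ T) + 6 * iv (j' ∈ T) + 6 * iv (i' = l)

noncomputable def u13 {n : ℕ} (T : Finset (Fin n)) (l : Fin n) (i' j' : Fin n) : ℝ :=
  6 * iv (i' ∈ T) + 3 * iv (j' ∈ T) + 3 * iv (j' = l)

noncomputable def u23 {n : ℕ} (i j i' j' : Fin n) : ℝ :=
  if i = i' ∧ j = j' then 15
  else if i = i' ∧ i = j' then 21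
  else if i = i' ∧ j ≠ i' ∧ i ≠ j' then 12
  else if j = i' ∧ i = j' then 15
  else if i = j' ∧ j ≠ i' ∧ i ≠ i' then 9
  else if i' = j' ∧ j = i' then 9
  else if j = i' ∧ i ≠ j' ∧ j ≠ j' then 6
  else if j = j' ∧ i' ≠ j' then 3
  else 0

/-- The Gram matrix U of the paper. -/
noncomputable def matU (n : ℕ) : Matrix (Idx n) (Idx n) ℝ :=
  Matrix.of fun x y =>
    match x, y with
    | .inl a, .inl b => u11 a.1.1 a.1.2 b.1.1 b.1.2
    | .inl a, .inr (.inl b) => u12 a.1.1 a.1.2 b.1.1 b.1.2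
    | .inl a, .inr (.inr b) => u13 a.1.1 a.1.2 b.1 b.2
    | .inr (.inl a), .inl b => u12 b.1.1 b.1.2 a.1.1 a.1.2
    | .inr (.inl a), .inr (.inl b) => u22 a.1.1 a.1.2 b.1.1 b.1.2
    | .inr (.inl a), .inr (.inr b) => u23 a.1.1 a.1.2 b.1 b.2
    | .inr (.inr a), .inl b => u13 b.1.1 b.1.2 a.1 a.2
    | .inr (.inr a), .inr (.inl b) => u23 b.1.1 b.1.2 a.1 a.2
    | .inr (.inr a), .inr (.inr b) => u33 a.1 a.2 b.1 b.2


set_option linter.all false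
set_option linter.unusedSimpArgs false
set_option linter.unusedTactic false

noncomputable def fX (n : ℕ) : Matrix (Idx n) (Fin n) ℝ :=
  Matrix.of fun x a =>
    match x with
    | .inl p => if a ∈ p.1.1 then 1 else 0
    | .inr (.inl p) => 2 * (if p.1.1 = a then 1 else 0) + (if p.1.2 = a then 1 else 0)
    | .inr (.inr p) => (if p.1 = a then 1 else 0) + (if p.2 = a then 1 / 2 else 0)

noncomputable def fY (n : ℕ) : Matrix (Idx n) (Fin n) ℝ :=
  Matrix.of fun x a =>
    match x with
    | .inl p => if p.1.2 = a then 1 else 0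
    | .inr (.inl p) => if p.1.1 = a then 1 else 0
    | .inr (.inr p) => (if p.2 = a then 1 / 2 else 0)

lemma sumI2 {n : ℕ} (f : Fin n → Fin n → ℝ) :
    ∑ p : I2 n, f p.1.1 p.1.2 = ∑ i, ∑ j, f i j - ∑ i, f i i := by
  have h1 : ∑ p : I2 n, f p.1.1 p.1.2
      = ∑ p : Fin n × Fin n, if p.1 ≠ p.2 then f p.1 p.2 else 0 := by
    rw [← Finset.sum_filter]
    exact (Finset.sum_subtype (Finset.univ.filter fun p : Fin n × Fin n => p.1 ≠ p.2)
      (p := fun p => p.1 ≠ p.2) (by simp) (fun p => f p.1 p.2)).symm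
  rw [h1, Fintype.sum_prod_type, ← Finset.sum_sub_distrib]
  refine Finset.sum_congr rfl fun i _ => ?_
  have : f i i = ∑ j, if i = j then f i j else 0 := by simp
  rw [this, ← Finset.sum_sub_distrib]
  refine Finset.sum_congr rfl fun j _ => ?_
  by_cases h : i = j <;> simp [h]

lemma sumI1 {n : ℕ} (f : Finset (Fin n) → Fin n → ℝ) :
    ∑ p : I1 n, f p.1.1 p.1.2
      = ∑ T ∈ Finset.powersetCard 3 (Finset.univ : Finset (Fin n)), ∑ l ∈ T, f T l := by
  have h1 : ∑ p : I1 n, f p.1.1 p.1.2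
      = ∑ p : Finset (Fin n) × Fin n, if p.1.card = 3 ∧ p.2 ∈ p.1 then f p.1 p.2 else 0 := by
    rw [← Finset.sum_filter]
    exact (Finset.sum_subtype
      (Finset.univ.filter fun p : Finset (Fin n) × Fin n => p.1.card = 3 ∧ p.2 ∈ p.1)
      (p := fun p => p.1.card = 3 ∧ p.2 ∈ p.1) (by simp) (fun p => f p.1 p.2)).symm
  rw [h1, Fintype.sum_prod_type]
  have h2 : Finset.powersetCard 3 (Finset.univ : Finset (Fin n))
      = Finset.univ.filter fun T => T.card = 3 := by
    ext T; simp [Finset.mem_powersetCard]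
  rw [h2, Finset.sum_filter]
  refine Finset.sum_congr rfl fun T _ => ?_
  by_cases h : T.card = 3 <;> simp [h]

noncomputable def cA (n : ℕ) (a b : Fin n) : ℝ :=
  ∑ T ∈ Finset.powersetCard 3 (Finset.univ : Finset (Fin n)), if a ∈ T ∧ b ∈ T then 1 else 0

lemma cA_ne {n : ℕ} (hn : 4 ≤ n) {a b : Fin n} (h : a ≠ b) : cA n a b = n - 2 := by
  unfold cA
  rw [Finset.sum_boole]
  have : (Finset.powersetCard 3 (Finset.univ : Finset (Fin n))).filter (fun T => a ∈ T ∧ b ∈ T)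
      = (Finset.univ \ {a, b}).image (fun c => ({c, a, b} : Finset (Fin n))) := by
    ext T
    simp only [Finset.mem_filter, Finset.mem_powersetCard, Finset.mem_image, Finset.mem_sdiff,
      Finset.mem_univ, true_and, Finset.subset_univ, Finset.mem_insert, Finset.mem_singleton]
    constructor
    · rintro ⟨h3, ha, hb⟩
      have hsub : ({a, b} : Finset (Fin n)) ⊆ T := by
        intro x; simp; rintro (rfl | rfl) <;> assumption
      have hc : (T \ {a, b}).card = 1 := by
        rw [Finset.card_sdiff_of_subset hsub, h3, Finset.card_pair h]
      obtain ⟨c, hc⟩ := Finset.card_eq_one.1 hc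
      have hcm : c ∈ T \ {a, b} := by rw [hc]; simp
      refine ⟨c, by simpa using (Finset.mem_sdiff.1 hcm).2, ?_⟩
      have := Finset.sdiff_union_of_subset hsub
      rw [hc] at this
      rw [← this]; rfl
    · rintro ⟨c, hc, rfl⟩
      refine ⟨Finset.card_eq_three.2 ⟨c, a, b, by tauto, by tauto, h, rfl⟩, by simp, by simp⟩
  rw [this, Finset.card_image_of_injOn, Finset.card_sdiff_of_subset (Finset.subset_univ _),
    Finset.card_pair h, Finset.card_univ, Fintype.card_fin, Nat.cast_sub (by omega)]
  · norm_num
  · intro c hc d hd hcd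
    simp at hc hd hcd
    have : c ∈ ({d, a, b} : Finset (Fin n)) := by rw [← hcd]; simp
    simp at this
    tauto

lemma cA_self {n : ℕ} (hn : 4 ≤ n) (a : Fin n) : cA n a a = (n - 1) * (n - 2) / 2 := by
  have h1 : ∑ b, cA n a b = 3 * cA n a a := by
    unfold cA
    rw [Finset.sum_comm, Finset.mul_sum]
    refine Finset.sum_congr rfl fun T hT => ?_
    have h3 := (Finset.mem_powersetCard.1 hT).2
    by_cases h : a ∈ T <;> simp [h, h3]
  have h2 : ∑ b, cA n a b = cA n a a + (n - 1) * (n - 2) := by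
    rw [← Finset.add_sum_erase _ _ (Finset.mem_univ a),
      Finset.sum_congr rfl (g := fun _ => ((n:ℝ) - 2))
        (fun b hb => cA_ne hn (Finset.ne_of_mem_erase hb).symm)]
    simp [Finset.card_erase_of_mem, Nat.cast_sub (show 1 ≤ n by omega)]
    try ring
  linarith

lemma cA_eq {n : ℕ} (hn : 4 ≤ n) (a b : Fin n) :
    cA n a b = (n - 2) + (n - 2) * (n - 3) / 2 * (if a = b then 1 else 0) := by
  by_cases h : a = b
  · subst h; rw [cA_self hn]; simp; ring
  · rw [cA_ne hn h]; simp [h]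

noncomputable def oJ (n : ℕ) : Matrix (Fin n) (Fin n) ℝ := Matrix.of fun _ _ => 1

lemma XtX {n : ℕ} (hn : 4 ≤ n) : (fX n)ᵀ * fX n =
    (3 * ((n:ℝ) - 2) * (n - 3) / 2 + 5 * (n - 1) - 4 + 5 / 4 * n) • (1 : Matrix (Fin n) (Fin n) ℝ)
      + (3 * ((n:ℝ) - 2) + 4 + 1) • oJ n := by
  ext a b
  have e1 : ∑ p : I1 n, (if a ∈ p.1.1 then (1:ℝ) else 0) * (if b ∈ p.1.1 then 1 else 0)
      = 3 * cA n a b := by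
    rw [sumI1 fun T l => (if a ∈ T then (1:ℝ) else 0) * (if b ∈ T then 1 else 0), cA,
      Finset.mul_sum]
    refine Finset.sum_congr rfl fun T hT => ?_
    have h3 := (Finset.mem_powersetCard.1 hT).2
    by_cases h : a ∈ T <;> by_cases h' : b ∈ T <;> simp [h, h', h3]
  have e2 := sumI2 fun i j : Fin n => (2 * (if i = a then (1:ℝ) else 0) + (if j = a then 1 else 0))
    * (2 * (if i = b then 1 else 0) + (if j = b then 1 else 0))
  simp only [Matrix.mul_apply, Matrix.transpose_apply, fX, Matrix.of_apply, Fintype.sum_sum_type,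
    e1, e2, cA_eq hn, Fintype.sum_prod_type]
  by_cases h : a = b
  · subst h
    simp [oJ, mul_add, add_mul, Finset.sum_add_distrib, ite_and, Matrix.one_apply]
    ring
  · have h' : b ≠ a := Ne.symm h
    simp [oJ, mul_add, add_mul, Finset.sum_add_distrib, ite_and, Matrix.one_apply, h, h']
    ring

lemma YtY {n : ℕ} (hn : 4 ≤ n) : (fY n)ᵀ * fY n =
    (((n:ℝ) - 1) * (n - 2) / 2 + (n - 1) + n / 4) • (1 : Matrix (Fin n) (Fin n) ℝ) := by
  ext a b
  have e1 : ∑ p : I1 n, (if p.1.2 = a then (1:ℝ) else 0) * (if p.1.2 = b then 1 else 0)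
      = if a = b then cA n a a else 0 := by
    rw [sumI1 fun T l => (if l = a then (1:ℝ) else 0) * (if l = b then 1 else 0), cA]
    by_cases hab : a = b
    · subst hab
      simp
    · simp [hab, Ne.symm hab]
  have e2 := sumI2 fun i j : Fin n => (if i = a then (1:ℝ) else 0) * (if i = b then 1 else 0)
  simp only [Matrix.mul_apply, Matrix.transpose_apply, fY, Matrix.of_apply, Fintype.sum_sum_type,
    e1, e2, cA_eq hn, Fintype.sum_prod_type]
  by_cases h : a = b
  · subst h
    simp []
    ring
  · have h' : b ≠ a := Ne.symm h
    simp [h, h']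

lemma YtX {n : ℕ} (hn : 4 ≤ n) : (fY n)ᵀ * fX n =
    (((n:ℝ) - 2) * (n - 3) / 2 + 2 * (n - 1) - 1 + n / 4) • (1 : Matrix (Fin n) (Fin n) ℝ)
      + (((n:ℝ) - 2) + 1 + 1 / 2) • oJ n := by
  ext a b
  have e1 : ∑ p : I1 n, (if p.1.2 = a then (1:ℝ) else 0) * (if b ∈ p.1.1 then 1 else 0)
      = cA n a b := by
    rw [sumI1 fun T l => (if l = a then (1:ℝ) else 0) * (if b ∈ T then 1 else 0), cA]
    refine Finset.sum_congr rfl fun T hT => ?_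
    by_cases h : a ∈ T <;> by_cases h' : b ∈ T <;> simp [h, h']
  have e2 := sumI2 fun i j : Fin n => (if i = a then (1:ℝ) else 0)
    * (2 * (if i = b then 1 else 0) + (if j = b then 1 else 0))
  simp only [Matrix.mul_apply, Matrix.transpose_apply, fX, fY, Matrix.of_apply,
    Fintype.sum_sum_type, e1, e2, cA_eq hn, Fintype.sum_prod_type]
  by_cases h : a = b
  · subst h
    simp [oJ, mul_add, add_mul, Finset.sum_add_distrib, Matrix.one_apply]
    ring
  · have h' : b ≠ a := Ne.symm h
    simp [oJ, mul_add, add_mul, Finset.sum_add_distrib, Matrix.one_apply, h, h']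
    ring

lemma XtY {n : ℕ} (hn : 4 ≤ n) : (fX n)ᵀ * fY n =
    (((n:ℝ) - 2) * (n - 3) / 2 + 2 * (n - 1) - 1 + n / 4) • (1 : Matrix (Fin n) (Fin n) ℝ)
      + (((n:ℝ) - 2) + 1 + 1 / 2) • oJ n := by
  have h := congrArg Matrix.transpose (YtX hn)
  have hJ : (oJ n)ᵀ = oJ n := rfl
  simpa [Matrix.transpose_mul, hJ] using h

lemma XJ (n : ℕ) : fX n * oJ n = (3:ℝ) • (fY n * oJ n) := by
  ext x a
  rcases x with ⟨⟨T, l⟩, h3, hl⟩ | p | p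
  · simp only at h3
    simp [Matrix.mul_apply, fX, fY, oJ, h3]
  · simp [Matrix.mul_apply, fX, fY, oJ, Finset.sum_add_distrib]; norm_num
  · simp [Matrix.mul_apply, fX, fY, oJ, Finset.sum_add_distrib]; norm_num

lemma JJ (n : ℕ) : oJ n * oJ n = (n:ℝ) • oJ n := by
  ext a b
  simp [Matrix.mul_apply, oJ]

lemma card_inter_eq {n : ℕ} (S T : Finset (Fin n)) :
    ((S ∩ T).card : ℝ) = ∑ a, (if a ∈ S then (1:ℝ) else 0) * (if a ∈ T then 1 else 0) := by
  simp [← ite_and, Finset.sum_boole, Finset.inter_comm]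
  try (congr 1; congr 1; ext; simp [and_comm])

lemma card_pair_inter {n : ℕ} {i j i' j' : Fin n} (h : i ≠ j) (h' : i' ≠ j') :
    ((({i, j} : Finset (Fin n)) ∩ ({i', j'} : Finset (Fin n))).card : ℝ)
      = (if i = i' then 1 else 0) + (if i = j' then 1 else 0) + (if j = i' then 1 else 0)
        + (if j = j' then 1 else 0) := by
  have key : ∀ {i j : Fin n}, i ≠ j → ∀ a, (if a ∈ ({i, j} : Finset (Fin n)) then (1:ℝ) else 0)
      = (if i = a then 1 else 0) + (if j = a then 1 else 0) := by
    intro i j h a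
    by_cases h1 : i = a
    · subst h1; simp [Ne.symm h]
    · by_cases h2 : j = a
      · subst h2; simp [h]
      · simp [h1, h2, Ne.symm h1, Ne.symm h2]
  rw [card_inter_eq]
  simp only [key h, key h']
  simp [mul_add, add_mul, Finset.sum_add_distrib, eq_comm]
  try ring

lemma matU_eq (n : ℕ) : matU n = (6:ℝ) • (fX n * (fX n)ᵀ + fY n * (fY n)ᵀ) := by
  ext x y
  rcases x with ⟨⟨T, l⟩, h3, hl⟩ | ⟨⟨i, j⟩, hij⟩ | ⟨i, j⟩ <;>
    rcases y with ⟨⟨T', l'⟩, h3', hl'⟩ | ⟨⟨i', j'⟩, hij'⟩ | ⟨i', j'⟩ <;>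
    (try replace hij : i ≠ j := hij) <;> (try replace hij' : i' ≠ j' := hij')
  · simp only [matU, u11, card_inter_eq, Matrix.of_apply, Matrix.smul_apply, Matrix.add_apply,
      Matrix.mul_apply, fX, fY, Matrix.transpose_apply, iv, smul_eq_mul]
    congr 2
    by_cases h : l = l'
    · simp [h]
    · simp [h, Ne.symm h]
  · simp [matU, u12, fX, fY, Matrix.mul_apply, iv, mul_add, add_mul, Finset.sum_add_distrib, eq_comm]
    try ring
  · simp [matU, u13, fX, fY, Matrix.mul_apply, iv, mul_add, add_mul, Finset.sum_add_distrib, eq_comm]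
    try ring
  · simp [matU, u12, fX, fY, Matrix.mul_apply, iv, mul_add, add_mul, Finset.sum_add_distrib, eq_comm]
    try ring
  · simp [matU, u22, fX, fY, Matrix.mul_apply, iv, mul_add, add_mul, Finset.sum_add_distrib, eq_comm]
    split_ifs <;> norm_num
  · simp [matU, u23, fX, fY, Matrix.mul_apply, mul_add, add_mul, Finset.sum_add_distrib]
    by_cases h1 : i = i' <;> by_cases h2 : i = j' <;> by_cases h3 : j = i' <;>
      by_cases h4 : j = j' <;> (try subst h1) <;> (try subst h2) <;> (try subst h3) <;>
      (try subst h4) <;> simp_all [eq_comm] <;> (try norm_num) <;> (try tauto)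
  · simp [matU, u13, fX, fY, Matrix.mul_apply, iv, mul_add, add_mul, Finset.sum_add_distrib, eq_comm]
    try ring
  · simp [matU, u23, fX, fY, Matrix.mul_apply, mul_add, add_mul, Finset.sum_add_distrib]
    by_cases h1 : i = i' <;> by_cases h2 : i = j' <;> by_cases h3 : j = i' <;>
      by_cases h4 : j = j' <;> (try subst h1) <;> (try subst h2) <;> (try subst h3) <;>
      (try subst h4) <;> simp_all [eq_comm] <;> (try norm_num) <;> (try tauto)
  · have hr : ((6:ℝ) • (fX n * (fX n)ᵀ + fY n * (fY n)ᵀ)) (.inr (.inr (i, j))) (.inr (.inr (i', j')))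
        = 6 * (if i = i' then 1 else 0) + 3 * (if i = j' then 1 else 0)
          + 3 * (if j = i' then 1 else 0) + 3 * (if j = j' then 1 else 0) := by
      simp [fX, fY, Matrix.mul_apply, mul_add, add_mul, Finset.sum_add_distrib, eq_comm]
      split_ifs <;> norm_num
    rw [hr]
    show u33 i j i' j' = _
    unfold u33 iv
    by_cases h : i ≠ j ∧ i' ≠ j'
    · rw [if_pos h, card_pair_inter h.1 h.2]; ring
    · rw [if_neg h]
      have h' : i = j ∨ i' = j' := by tauto
      rcases h' with rfl | rfl <;> ring

/-- U satisfies U⁴ + fU³ + gU² + hU = 0 for n ≥ 4. -/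
theorem matU_satisfies_mu (n : ℕ) (hn : 4 ≤ n) :
    matU n ^ 4 + (-42 * (n : ℝ) ^ 2 + 24 * n) • matU n ^ 3 +
      (378 * (n : ℝ) ^ 4 - 477 * (n : ℝ) ^ 3 + 144 * (n : ℝ) ^ 2) • matU n ^ 2 +
      (-540 * (n : ℝ) ^ 6 + 1080 * (n : ℝ) ^ 5 - 675 * (n : ℝ) ^ 4 + 135 * (n : ℝ) ^ 3) • matU n
      = 0 := by
  have hU := matU_eq n
  have hxx := XtX hn
  have hyy := YtY hn
  have hyx := YtX hn
  have hxy := XtY hn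
  have hXJ := XJ n
  have hJJ := JJ n
  generalize matU n = U at *
  generalize fX n = X at *
  generalize fY n = Y at *
  generalize oJ n = J at *
  generalize (n : ℝ) = m at *
  obtain ⟨K, hK⟩ : ∃ K, K = Y * J := ⟨_, rfl⟩
  rw [← hK] at hXJ
  have hKJ : K * J = m • K := by rw [hK, Matrix.mul_assoc, hJJ, Matrix.mul_smul]
  have hUX : U * X = (6 * (3 * (m - 2) * (m - 3) / 2 + 5 * (m - 1) - 4 + 5 / 4 * m)) • X
      + (6 * ((m - 2) * (m - 3) / 2 + 2 * (m - 1) - 1 + m / 4)) • Y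
      + (6 * (3 * (3 * (m - 2) + 4 + 1) + ((m - 2) + 1 + 1 / 2))) • K := by
    rw [hU, Matrix.smul_mul, Matrix.add_mul, Matrix.mul_assoc, Matrix.mul_assoc, hxx, hyx]
    simp only [Matrix.mul_add, Matrix.mul_smul, Matrix.mul_one, hXJ, ← hK]
    module
  have hUY : U * Y = (6 * ((m - 2) * (m - 3) / 2 + 2 * (m - 1) - 1 + m / 4)) • X
      + (6 * ((m - 1) * (m - 2) / 2 + (m - 1) + m / 4)) • Y
      + (6 * (3 * ((m - 2) + 1 + 1 / 2))) • K := by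
    rw [hU, Matrix.smul_mul, Matrix.add_mul, Matrix.mul_assoc, Matrix.mul_assoc, hxy, hyy]
    simp only [Matrix.mul_add, Matrix.mul_smul, Matrix.mul_one, hXJ]
    module
  have hUK : U * K = (15 * m * (2 * m - 1)) • K := by
    rw [hK, ← Matrix.mul_assoc, hUY]
    simp only [Matrix.add_mul, Matrix.smul_mul, hXJ, hKJ, ← hK]
    module
  clear hxx hyy hyx hxy hJJ hKJ hXJ hK
  have main : ∀ Z, (Z = X ∨ Z = Y) → U * (U * (U * Z)) + (-42 * m ^ 2 + 24 * m) • (U * (U * Z)) +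
      (378 * m ^ 4 - 477 * m ^ 3 + 144 * m ^ 2) • (U * Z) +
      (-540 * m ^ 6 + 1080 * m ^ 5 - 675 * m ^ 4 + 135 * m ^ 3) • Z = 0 := by
    rintro Z (rfl | rfl)
    · simp only [hUX, hUY, hUK, Matrix.mul_add, Matrix.mul_smul]
      module
    · simp only [hUX, hUY, hUK, Matrix.mul_add, Matrix.mul_smul]
      module
  have hX := congrArg (· * Xᵀ) (main X (Or.inl rfl))
  have hY := congrArg (· * Yᵀ) (main Y (Or.inr rfl))
  simp only [Matrix.add_mul, Matrix.smul_mul, Matrix.zero_mul, Matrix.mul_assoc] at hX hY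
  have key : ∀ V, V = (6:ℝ) • (X * Xᵀ + Y * Yᵀ) →
      U * (U * (U * V)) + (-42 * m ^ 2 + 24 * m) • (U * (U * V)) +
      (378 * m ^ 4 - 477 * m ^ 3 + 144 * m ^ 2) • (U * V) +
      (-540 * m ^ 6 + 1080 * m ^ 5 - 675 * m ^ 4 + 135 * m ^ 3) • V = 0 := by
    intro V hV
    simp only [hV, Matrix.mul_smul, Matrix.mul_add]
    linear_combination (norm := module) (6:ℝ) • hX + (6:ℝ) • hY
  have e4 : U ^ 4 = U * (U * (U * U)) := by simp only [pow_succ, pow_zero, one_mul, mul_assoc]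
  have e3 : U ^ 3 = U * (U * U) := by simp only [pow_succ, pow_zero, one_mul, mul_assoc]
  have e2 : U ^ 2 = U * U := pow_two U
  rw [e4, e3, e2]
  exact key U hU
end

section
/- Fix an integer n ≥ 4. Let U be the real symmetric matrix defined as follows. Its index set is I₁ ⊔ I₂ ⊔ I₃, where I₁ = {(T,ℓ) : T a 3-element subset of {1,…,n}, ℓ ∈ T}, I₂ = {(i,j) : i,j ∈ {1,…,n}, i ≠ j}, and I₃ = {1,…,n} × {1,…,n} with elements written (î,ĵ). Using Iverson brackets [P] ∈ {0,1}, the entries of U are: for (T,ℓ), (T′,ℓ′) ∈ I₁: 6(|T ∩ T′| + [ℓ = ℓ′]); for (i,j), (i′,j′) ∈ I₂: 6[j = j′] + 30[i = i′] + 12[i = j′] + 12[j = i′]; for (î,ĵ), (î′,ĵ′) ∈ I₃: 3(|{î,ĵ} ∩ {î′,ĵ′}| + [î = î′]) if î ≠ ĵ and î′ ≠ ĵ′, and 3(3[î = î′] + 2[ĵ = ĵ′]) if î = ĵ or î′ = ĵ′; for (T,ℓ) ∈ I₁ and (i′,j′) ∈ I₂: 12[i′ ∈ T] + 6[j′ ∈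 T] + 6[i′ = ℓ]; for (T,ℓ) ∈ I₁ and (î,ĵ) ∈ I₃: 6[î ∈ T] + 3[ĵ ∈ T] + 3[ĵ = ℓ]; for (i,j) ∈ I₂ and (î,ĵ) ∈ I₃: 15 if i = î and j = ĵ; otherwise 21 if i = î and i = ĵ; otherwise 12 if i = î and j ≠ î and i ≠ ĵ; otherwise 15 if j = î and i = ĵ; otherwise 9 if i = ĵ and j ≠ î and i ≠ î; otherwise 9 if î = ĵ and j = î; otherwise 6 if j = î and i ≠ ĵ and j ≠ ĵ; otherwise 3 if j = ĵ and î ≠ ĵ; otherwise 0; and the entries with row index in a later block than the column index are given by symmetry. Let e_α denote the standard basis vector at index α. Then for all pairwise distinct i, j, k ∈ {1,…,n−1}, the vector e_{({i,j,k},i)} − e_{(ĵ,n̂)} − e_{(k̂,n̂)} − 2e_{(n̂,î)} + 2e_{(n̂,n̂)} lies in the kernel of U: U applied to this vector is the zero vector. -/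
open Matrix

theorem aux_card3 {n : ℕ} (S : Finset (Fin n)) (i j k : Fin n)
    (hij : i ≠ j) (hik : i ≠ k) (hjk : j ≠ k) :
    ((S ∩ {i, j, k}).card : ℝ) = iv (i ∈ S) + iv (j ∈ S) + iv (k ∈ S) := by
  have h : S ∩ {i, j, k} = ({i, j, k} : Finset (Fin n)).filter (· ∈ S) := by
    ext x; simp [and_comm]
  rw [h, Finset.card_filter, Finset.sum_insert (by simp [hij, hik]),
    Finset.sum_insert (by simp [hjk]), Finset.sum_singleton]
  simp only [iv]
  push_cast
  ring

theorem aux_card2 {n : ℕ} (S : Finset (Fin n)) (i j : Fin n) (hij : i ≠ j) :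
    ((S ∩ {i, j}).card : ℝ) = iv (i ∈ S) + iv (j ∈ S) := by
  have h : S ∩ {i, j} = ({i, j} : Finset (Fin n)).filter (· ∈ S) := by
    ext x; simp [and_comm]
  rw [h, Finset.card_filter, Finset.sum_insert (by simp [hij]), Finset.sum_singleton]
  simp only [iv]
  push_cast
  ring

theorem aux_b1 {n : ℕ} (S : Finset (Fin n)) (l i j k N : Fin n)
    (hij : i ≠ j) (hik : i ≠ k) (hjk : j ≠ k) :
    u11 S l {i, j, k} i - u13 S l j N - u13 S l k N - 2 * u13 S l N i + 2 * u13 S l N N = 0 := by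
  simp only [u11, u13, aux_card3 S i j k hij hik hjk]
  have : iv (l = i) = iv (i = l) := by simp only [iv, eq_comm]
  rw [this]; ring

theorem aux_cases {n : ℕ} (p i j k N : Fin n) :
    p = i ∨ p = j ∨ p = k ∨ p = N ∨ (p ≠ i ∧ p ≠ j ∧ p ≠ k ∧ p ≠ N) := by tauto

theorem aux_b2 {n : ℕ} (p q i j k N : Fin n) (hpq : p ≠ q)
    (hij : i ≠ j) (hik : i ≠ k) (hjk : j ≠ k) (hi : i ≠ N) (hj : j ≠ N) (hk : k ≠ N) :
    u12 {i, j, k} i p q - u23 p q j N - u23 p q k N - 2 * u23 p q N i + 2 * u23 p q N N = 0 := by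
  simp only [u12, u23, iv, Finset.mem_insert, Finset.mem_singleton]
  rcases aux_cases p i j k N with h | h | h | h | ⟨h1, h2, h3, h4⟩ <;>
    (try subst h) <;> grind

theorem aux_b3 {n : ℕ} (p q i j k N : Fin n)
    (hij : i ≠ j) (hik : i ≠ k) (hjk : j ≠ k) (hi : i ≠ N) (hj : j ≠ N) (hk : k ≠ N) :
    u13 {i, j, k} i p q - u33 p q j N - u33 p q k N - 2 * u33 p q N i + 2 * u33 p q N N = 0 := by
  simp only [u13, u33, aux_card2 _ j N hj, aux_card2 _ k N hk, aux_card2 _ N i hi.symm, iv,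
    Finset.mem_insert, Finset.mem_singleton]
  by_cases hpq : p = q
  · subst hpq
    rcases aux_cases p i j k N with h | h | h | h | ⟨h1, h2, h3, h4⟩ <;>
      (try subst h) <;> grind
  · rcases aux_cases p i j k N with h | h | h | h | ⟨h1, h2, h3, h4⟩ <;>
      (try subst h) <;> grind

/-- the vectors e_{({i,j,k},i)} − e_{(ĵ,n̂)} − e_{(k̂,n̂)} − 2e_{(n̂,î)} + 2e_{(n̂,n̂)}
(first index in block 1, the rest in block 3, with n̂ the last index) lie in the kernel of U,
whenever i, j, k are pairwise distinct and different from the last index. -/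
theorem matU_kernel_block1 (n : ℕ) (hn : 4 ≤ n) (i j k : Fin n)
    (hij : i ≠ j) (hik : i ≠ k) (hjk : j ≠ k)
    (hi : i ≠ (⟨n - 1, by omega⟩ : Fin n)) (hj : j ≠ (⟨n - 1, by omega⟩ : Fin n))
    (hk : k ≠ (⟨n - 1, by omega⟩ : Fin n)) :
    matU n *ᵥ
      (Pi.single (Sum.inl ⟨(({i, j, k} : Finset (Fin n)), i),
          Finset.card_eq_three.mpr ⟨i, j, k, hij, hik, hjk, rfl⟩, by simp⟩ : Idx n) (1 : ℝ)
        - Pi.single (Sum.inr (Sum.inr (j, (⟨n - 1, by omega⟩ : Fin n))) : Idx n) 1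
        - Pi.single (Sum.inr (Sum.inr (k, (⟨n - 1, by omega⟩ : Fin n))) : Idx n) 1
        - Pi.single (Sum.inr (Sum.inr ((⟨n - 1, by omega⟩ : Fin n), i)) : Idx n) 2
        + Pi.single (Sum.inr (Sum.inr ((⟨n - 1, by omega⟩ : Fin n), (⟨n - 1, by omega⟩ : Fin n))) : Idx n) 2)
    = 0 := by
  generalize_proofs _ pN pT
  generalize (⟨n - 1, pN⟩ : Fin n) = N at *
  funext x
  simp only [Matrix.mulVec_add, Matrix.mulVec_sub, Matrix.mulVec_single, Pi.add_apply,
    Pi.sub_apply, Pi.smul_apply, Matrix.col_apply, Pi.zero_apply, MulOpposite.smul_eq_mul_unop,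
    MulOpposite.unop_op, mul_one]
  rcases x with ⟨⟨S, l⟩, hS⟩ | ⟨⟨p, q⟩, hpq⟩ | ⟨p, q⟩
  · have := aux_b1 S l i j k N hij hik hjk
    simp only [matU, Matrix.of_apply]
    linarith
  · have := aux_b2 p q i j k N hpq hij hik hjk hi hj hk
    simp only [matU, Matrix.of_apply]
    linarith
  · have := aux_b3 p q i j k N hij hik hjk hi hj hk
    simp only [matU, Matrix.of_apply]
    linarith
end

section
/- Fix an integer n ≥ 3. Let U be the real symmetric matrix defined as follows. Its index set is I₁ ⊔ I₂ ⊔ I₃, where I₁ = {(T,ℓ) : T a 3-element subset of {1,…,n}, ℓ ∈ T}, I₂ = {(i,j) : i,j ∈ {1,…,n}, i ≠ j}, and I₃ = {1,…,n} × {1,…,n} with elements written (î,ĵ). Using Iverson brackets [P] ∈ {0,1}, the entries of U are: for (T,ℓ), (T′,ℓ′) ∈ I₁: 6(|T ∩ T′| + [ℓ = ℓ′]); for (i,j), (i′,j′) ∈ I₂: 6[j = j′] + 30[i = i′] + 12[i = j′] + 12[j = i′]; for (î,ĵ), (î′,ĵ′) ∈ I₃: 3(|{î,ĵ} ∩ {î′,ĵ′}|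 + [î = î′]) if î ≠ ĵ and î′ ≠ ĵ′, and 3(3[î = î′] + 2[ĵ = ĵ′]) if î = ĵ or î′ = ĵ′; for (T,ℓ) ∈ I₁ and (i′,j′) ∈ I₂: 12[i′ ∈ T] + 6[j′ ∈ T] + 6[i′ = ℓ]; for (T,ℓ) ∈ I₁ and (î,ĵ) ∈ I₃: 6[î ∈ T] + 3[ĵ ∈ T] + 3[ĵ = ℓ]; for (i,j) ∈ I₂ and (î,ĵ) ∈ I₃: 15 if i = î and j = ĵ; otherwise 21 if i = î and i = ĵ; otherwise 12 if i = î and j ≠ î and i ≠ ĵ; otherwise 15 if j = î and i = ĵ; otherwise 9 if i = ĵ and j ≠ î and i ≠ î; otherwise 9 if î = ĵ and j = î; otherwise 6 if j = î and i ≠ ĵ and j ≠ ĵ; otherwise 3 if j = ĵ and î ≠ ĵ; otherwise 0; and the entries with row index in a later block than the column index are given by symmetry. Let e_α denote the standard basis vector at index α. Then for all distinct i, j ∈ {1,…,n−1}, the vector e_{(i,j)} − e_{(î,n̂)} − e_{(ĵ,n̂)} − 2e_{(n̂,î)} + 2e_{(n̂,n̂)} lies in the kernel of U: U applied to this vector is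 the zero vector. -/
open Matrix

theorem card_aux {n : ℕ} (i j k l : Fin n) (h : i ≠ j) :
    (((({i, j} : Finset (Fin n)) ∩ ({k, l} : Finset (Fin n))).card : ℕ) : ℝ)
      = (if i = k ∨ i = l then 1 else 0) + (if j = k ∨ j = l then 1 else 0) := by
  have h' : ({i, j} : Finset (Fin n)) ∩ {k, l}
      = ({i, j} : Finset (Fin n)).filter (fun x => x = k ∨ x = l) := by
    ext x; simp
  rw [h', Finset.card_filter, Finset.sum_pair h]
  push_cast
  rfl

theorem row2_aux {n : ℕ} (N i j a b : Fin n) (hij : i ≠ j) (hi : i ≠ N) (hj : j ≠ N) (hab : a ≠ b) :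
    u22 a b i j - u23 a b i N - u23 a b j N - u23 a b N i * 2 + u23 a b N N * 2 = 0 := by
  unfold u22 u23 iv
  by_cases h1 : a = i <;> by_cases h2 : a = j <;> by_cases h3 : a = N <;>
  by_cases h4 : b = i <;> by_cases h5 : b = j <;> by_cases h6 : b = N <;>
  first
  | (exfalso; grind)
  | (simp [h1, h2, h3, h4, h5, h6, hij, hi, hj, hij.symm, hi.symm, hj.symm]; try norm_num)

theorem row3_aux {n : ℕ} (N i j a b : Fin n) (hij : i ≠ j) (hi : i ≠ N) (hj : j ≠ N) :
    u23 i j a b - u33 a b i N - u33 a b j N - u33 a b N i * 2 + u33 a b N N * 2 = 0 := by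
  by_cases hab : a = b
  · subst hab
    unfold u33 u23 iv
    by_cases h1 : a = i <;> by_cases h2 : a = j <;> by_cases h3 : a = N <;>
    first
    | (exfalso; grind)
    | (simp [h1, h2, h3, Ne.symm h1, Ne.symm h2, hij, hi, hj, hij.symm, hi.symm, hj.symm]; try norm_num)
    | (simp [h1, h2, h3, eq_comm (b := a), hij, hi, hj, hij.symm, hi.symm, hj.symm]; try norm_num)
  · unfold u33 u23 iv
    simp only [card_aux a b _ _ hab]
    have e1 : (i = a) = (a = i) := propext eq_comm
    have e2 : (i = b) = (b = i) := propext eq_comm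
    have e3 : (j = a) = (a = j) := propext eq_comm
    have e4 : (j = b) = (b = j) := propext eq_comm
    simp only [e1, e2, e3, e4, ne_eq, hab]
    by_cases h1 : a = i <;> by_cases h2 : a = j <;> by_cases h3 : a = N <;>
    by_cases h4 : b = i <;> by_cases h5 : b = j <;> by_cases h6 : b = N <;>
    first
    | (exfalso; grind)
    | (simp [h1, h2, h3, h4, h5, h6, hij, hi, hj, hij.symm, hi.symm, hj.symm]; try norm_num)

/-- the vectors e_{(i,j)} − e_{(î,n̂)} − e_{(ĵ,n̂)} − 2e_{(n̂,î)} + 2e_{(n̂,n̂)}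
(first index in block 2, the rest in block 3, with n̂ the last index) lie in the kernel of U,
whenever i ≠ j and both differ from the last index. -/
theorem matU_kernel_block2 (n : ℕ) (hn : 3 ≤ n) (i j : Fin n) (hij : i ≠ j)
    (hi : i ≠ (⟨n - 1, by omega⟩ : Fin n)) (hj : j ≠ (⟨n - 1, by omega⟩ : Fin n)) :
    matU n *ᵥ
      (Pi.single (Sum.inr (Sum.inl ⟨(i, j), hij⟩) : Idx n) (1 : ℝ)
        - Pi.single (Sum.inr (Sum.inr (i, (⟨n - 1, by omega⟩ : Fin n))) : Idx n) 1
        - Pi.single (Sum.inr (Sum.inr (j, (⟨n - 1, by omega⟩ : Fin n))) : Idx n) 1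
        - Pi.single (Sum.inr (Sum.inr ((⟨n - 1, by omega⟩ : Fin n), i)) : Idx n) 2
        + Pi.single (Sum.inr (Sum.inr ((⟨n - 1, by omega⟩ : Fin n), (⟨n - 1, by omega⟩ : Fin n))) : Idx n) 2)
    = 0 := by
  ext x
  simp only [Matrix.mulVec_add, Matrix.mulVec_sub, Matrix.mulVec_single, Pi.add_apply,
    Pi.sub_apply, Pi.smul_apply, Matrix.col_apply, MulOpposite.smul_eq_mul_unop,
    MulOpposite.unop_op, Pi.zero_apply, mul_one]
  rcases x with a | a | a
  · simp only [matU, Matrix.of_apply, u12, u13]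
    ring
  · exact row2_aux _ i j a.1.1 a.1.2 hij hi hj a.2
  · exact row3_aux _ i j a.1 a.2 hij hi hj
end

section
/- Fix an integer n ≥ 6. Let U be the real symmetric matrix defined as follows. Its index set is I₁ ⊔ I₂ ⊔ I₃, where I₁ = {(T,ℓ) : T a 3-element subset of {1,…,n}, ℓ ∈ T}, I₂ = {(i,j) : i,j ∈ {1,…,n}, i ≠ j}, and I₃ = {1,…,n} × {1,…,n} with elements written (î,ĵ). Using Iverson brackets [P] ∈ {0,1}, the entries of U are: for (T,ℓ), (T′,ℓ′) ∈ I₁: 6(|T ∩ T′| + [ℓ = ℓ′]); for (i,j), (i′,j′) ∈ I₂: 6[j = j′] + 30[i = i′] + 12[i = j′] + 12[j = i′]; for (î,ĵ), (î′,ĵ′) ∈ I₃: 3(|{î,ĵ} ∩ {î′,ĵ′}| + [î = î′]) if î ≠ ĵ and î′ ≠ ĵ′, and 3(3[î = î′] + 2[ĵ = ĵ′]) if î = ĵ or î′ = ĵ′; for (T,ℓ) ∈ I₁ and (i′,j′) ∈ I₂: 12[i′ ∈ T] + 6[j′ ∈ T] + 6[i′ = ℓ]; for (T,ℓ) ∈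 I₁ and (î,ĵ) ∈ I₃: 6[î ∈ T] + 3[ĵ ∈ T] + 3[ĵ = ℓ]; for (i,j) ∈ I₂ and (î,ĵ) ∈ I₃: 15 if i = î and j = ĵ; otherwise 21 if i = î and i = ĵ; otherwise 12 if i = î and j ≠ î and i ≠ ĵ; otherwise 15 if j = î and i = ĵ; otherwise 9 if i = ĵ and j ≠ î and i ≠ î; otherwise 9 if î = ĵ and j = î; otherwise 6 if j = î and i ≠ ĵ and j ≠ ĵ; otherwise 3 if j = ĵ and î ≠ ĵ; otherwise 0; and the entries with row index in a later block than the column index are given by symmetry. Then for every 3-element subset T of {1,…,n} and every ℓ ∈ T, the diagonal entry of U² at row and column (T,ℓ) equals 216n² + 1026n − 432. -/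
open Matrix

lemma aux_count {n : ℕ} (S : Finset (Fin n)) (hS : S.card ≤ 3) :
    ((Finset.powersetCard 3 (Finset.univ : Finset (Fin n))).filter (fun A => S ⊆ A)).card
      = (n - S.card).choose (3 - S.card) := by
  have h : (Finset.powersetCard (3 - S.card) Sᶜ).card = (n - S.card).choose (3 - S.card) := by
    rw [Finset.card_powersetCard, Finset.card_compl, Fintype.card_fin]
  rw [← h]
  refine Finset.card_bij' (fun A _ => A \ S) (fun B _ => B ∪ S) ?_ ?_ ?_ ?_
  · intro A hA
    simp only [Finset.mem_filter, Finset.mem_powersetCard] at hA ⊢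
    refine ⟨?_, ?_⟩
    · intro x hx
      simp at hx ⊢
      exact hx.2
    · rw [Finset.card_sdiff_of_subset hA.2, hA.1.2]
  · intro B hB
    simp only [Finset.mem_filter, Finset.mem_powersetCard] at hB ⊢
    refine ⟨⟨Finset.subset_univ _, ?_⟩, Finset.subset_union_right⟩
    rw [Finset.card_union_of_disjoint, hB.2]
    · omega
    · exact Finset.disjoint_left.mpr fun x hx => by simpa using hB.1 hx
  · intro A hA
    simp only [Finset.mem_filter] at hA
    exact Finset.sdiff_union_of_subset hA.2
  · intro B hB
    simp only [Finset.mem_powersetCard] at hB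
    apply Finset.union_sdiff_cancel_right
    exact Finset.disjoint_left.mpr fun x hx => by simpa using hB.1 hx

lemma aux_count2 {n : ℕ} (hn : 6 ≤ n) (x y : Fin n) :
    ∑ A ∈ Finset.powersetCard 3 (Finset.univ : Finset (Fin n)), iv (x ∈ A) * iv (y ∈ A)
      = if x = y then ((n : ℝ) - 1) * (n - 2) / 2 else (n : ℝ) - 2 := by
  have h1 : ∀ A : Finset (Fin n), iv (x ∈ A) * iv (y ∈ A) = if ({x, y} : Finset (Fin n)) ⊆ A then 1 else 0 := by
    intro A
    by_cases hx : x ∈ A <;> by_cases hy : y ∈ A <;> simp [iv, hx, hy, Finset.insert_subset_iff]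
  simp only [h1, Finset.sum_boole]
  by_cases hxy : x = y
  · subst hxy
    rw [aux_count _ (by simp)]
    obtain ⟨m, rfl⟩ : ∃ m, n = m + 1 := ⟨n - 1, by omega⟩
    simp [Nat.cast_choose_two]
    left; ring
  · rw [aux_count _ (by rw [Finset.card_pair hxy]; norm_num), Finset.card_pair hxy]
    simp [hxy]
    rw [Nat.cast_sub (by omega)]
    norm_num

lemma aux_card {n : ℕ} (T A : Finset (Fin n)) :
    ((T ∩ A).card : ℝ) = ∑ x ∈ T, iv (x ∈ A) := by
  simp only [iv, Finset.sum_boole, Finset.filter_mem_eq_inter]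

lemma aux_k {n : ℕ} (hn : 6 ≤ n) (T : Finset (Fin n)) (hT : T.card = 3) (l : Fin n) (hl : l ∈ T) :
    ∑ A ∈ Finset.powersetCard 3 (Finset.univ : Finset (Fin n)), ((T ∩ A).card : ℝ) * iv (l ∈ A)
      = ((n : ℝ) - 1) * (n - 2) / 2 + 2 * (n - 2) := by
  simp only [aux_card, Finset.sum_mul]
  rw [Finset.sum_comm]
  simp only [aux_count2 hn]
  rw [← Finset.add_sum_erase _ _ hl]
  rw [Finset.sum_congr rfl (g := fun _ => (n : ℝ) - 2)]
  · simp [Finset.card_erase_of_mem hl, hT]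
    ring
  · intro x hx
    simp [Finset.ne_of_mem_erase hx]

lemma aux_kk {n : ℕ} (hn : 6 ≤ n) (T : Finset (Fin n)) (hT : T.card = 3) :
    ∑ A ∈ Finset.powersetCard 3 (Finset.univ : Finset (Fin n)), ((T ∩ A).card : ℝ) * ((T ∩ A).card : ℝ)
      = 3 * (((n : ℝ) - 1) * (n - 2) / 2 + 2 * (n - 2)) := by
  have : ∀ A : Finset (Fin n), ((T ∩ A).card : ℝ) * ((T ∩ A).card : ℝ)
      = ∑ x ∈ T, ((T ∩ A).card : ℝ) * iv (x ∈ A) := by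
    intro A
    rw [← Finset.mul_sum, ← aux_card]
  simp only [this]
  rw [Finset.sum_comm, Finset.sum_congr rfl (fun x hx => aux_k hn T hT x hx)]
  simp [hT]
  ring

lemma aux_block1 {n : ℕ} (hn : 6 ≤ n) (T : Finset (Fin n)) (hT : T.card = 3) (l : Fin n) (hl : l ∈ T) :
    ∑ p : I1 n, u11 T l p.1.1 p.1.2 * u11 T l p.1.1 p.1.2
      = 216 * (n : ℝ) ^ 2 + 144 * n - 1152 := by
  have h0 : ∑ p : I1 n, u11 T l p.1.1 p.1.2 * u11 T l p.1.1 p.1.2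
      = ∑ A ∈ Finset.powersetCard 3 (Finset.univ : Finset (Fin n)),
          ∑ m ∈ A, u11 T l A m * u11 T l A m := by
    rw [← Finset.sum_subtype (Finset.univ.filter
      (fun p : Finset (Fin n) × Fin n => p.1.card = 3 ∧ p.2 ∈ p.1)) (by simp)
      (fun p => u11 T l p.1 p.2 * u11 T l p.1 p.2)]
    refine Finset.sum_finset_product' (f := fun A m => u11 T l A m * u11 T l A m) _
      (Finset.powersetCard 3 (Finset.univ : Finset (Fin n))) (fun A => A) ?_
    simp [Finset.mem_powersetCard]
  rw [h0]
  have h1 : ∀ A ∈ Finset.powersetCard 3 (Finset.univ : Finset (Fin n)),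
      ∑ m ∈ A, u11 T l A m * u11 T l A m
        = 108 * (((T ∩ A).card : ℝ) * ((T ∩ A).card : ℝ)) + 72 * (((T ∩ A).card : ℝ) * iv (l ∈ A))
          + 36 * (iv (l ∈ A) * iv (l ∈ A)) := by
    intro A hA
    have hA3 := (Finset.mem_powersetCard.mp hA).2
    have h2 : ∀ m, u11 T l A m * u11 T l A m = 36 * (((T ∩ A).card : ℝ) * ((T ∩ A).card : ℝ))
        + (72 * ((T ∩ A).card : ℝ) + 36) * iv (l = m) := by
      intro m
      unfold u11 iv
      split_ifs <;> ring
    simp only [h2, Finset.sum_add_distrib, ← Finset.mul_sum, Finset.sum_const, hA3]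
    simp only [iv, Finset.sum_ite_eq]
    split_ifs <;> simp <;> ring
  rw [Finset.sum_congr rfl h1]
  simp only [Finset.sum_add_distrib, ← Finset.mul_sum]
  rw [aux_kk hn T hT, aux_k hn T hT l hl, aux_count2 hn]
  simp
  ring

lemma aux_sum {n : ℕ} (T : Finset (Fin n)) (hT : T.card = 3) : ∑ i, iv (i ∈ T) = 3 := by
  simp [iv, hT]

lemma aux_sum' {n : ℕ} (l : Fin n) : ∑ i, iv (i = l) = 1 := by
  simp [iv]

lemma aux_block3 {n : ℕ} (T : Finset (Fin n)) (hT : T.card = 3) (l : Fin n) (hl : l ∈ T) :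
    ∑ p : I3 n, u13 T l p.1 p.2 * u13 T l p.1 p.2 = 162 * (n : ℝ) + 432 := by
  rw [Fintype.sum_prod_type]
  have h : ∀ i j, u13 T l i j * u13 T l i j
      = 36 * iv (i ∈ T) + 9 * iv (j ∈ T) + 27 * iv (j = l) + 36 * (iv (i ∈ T) * iv (j ∈ T))
        + 36 * (iv (i ∈ T) * iv (j = l)) := by
    intro i j
    unfold u13 iv
    by_cases hj : j = l
    · subst hj
      simp only [hl]
      split_ifs <;> norm_num
    · split_ifs <;> norm_num
  simp only [h, Finset.sum_add_distrib, ← Finset.mul_sum, ← Finset.sum_mul, Finset.sum_const,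
    nsmul_eq_mul, aux_sum T hT, aux_sum']
  simp
  ring

lemma aux_block2 {n : ℕ} (T : Finset (Fin n)) (hT : T.card = 3) (l : Fin n) (hl : l ∈ T) :
    ∑ p : I2 n, u12 T l p.1.1 p.1.2 * u12 T l p.1.1 p.1.2 = 720 * (n : ℝ) + 288 := by
  have h : ∀ i j, u12 T l i j * u12 T l i j
      = 144 * iv (i ∈ T) + 36 * iv (j ∈ T) + 180 * iv (i = l) + 144 * (iv (i ∈ T) * iv (j ∈ T))
        + 72 * (iv (i = l) * iv (j ∈ T)) := by
    intro i j
    unfold u12 iv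
    by_cases hj : i = l
    · subst hj
      simp only [hl]
      split_ifs <;> norm_num
    · split_ifs <;> norm_num
  have hd : ∀ i, u12 T l i i * u12 T l i i = 324 * iv (i ∈ T) + 252 * iv (i = l) := by
    intro i
    unfold u12 iv
    by_cases hj : i = l
    · subst hj
      simp only [hl]
      norm_num
    · split_ifs <;> norm_num
  have h0 : ∑ p : I2 n, u12 T l p.1.1 p.1.2 * u12 T l p.1.1 p.1.2
      = ∑ i, ∑ j, (u12 T l i j * u12 T l i j - if i = j then u12 T l i i * u12 T l i i else 0) := by
    rw [← Finset.sum_subtype (Finset.univ.filter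
      (fun p : Fin n × Fin n => p.1 ≠ p.2)) (by simp)
      (fun p => u12 T l p.1 p.2 * u12 T l p.1 p.2), Finset.sum_filter, Fintype.sum_prod_type]
    refine Finset.sum_congr rfl fun i _ => Finset.sum_congr rfl fun j _ => ?_
    by_cases hij : i = j
    · subst hij; simp
    · simp [hij]
  rw [h0]
  simp only [Finset.sum_sub_distrib, Finset.sum_ite_eq, Finset.mem_univ, if_true, hd]
  simp only [h, Finset.sum_add_distrib, ← Finset.mul_sum, ← Finset.sum_mul, Finset.sum_const,
    nsmul_eq_mul, aux_sum T hT, aux_sum']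
  simp
  ring

/-- for n ≥ 6, every diagonal entry of U² on the first index block
equals 216n² + 1026n − 432. -/
theorem matU_sq_diag_block1 (n : ℕ) (hn : 6 ≤ n) (T : Finset (Fin n)) (l : Fin n)
    (hT : T.card = 3) (hl : l ∈ T) :
    (matU n ^ 2) (Sum.inl ⟨(T, l), hT, hl⟩) (Sum.inl ⟨(T, l), hT, hl⟩)
      = 216 * (n : ℝ) ^ 2 + 1026 * (n : ℝ) - 432 := by
  rw [pow_two, Matrix.mul_apply, Fintype.sum_sum_type, Fintype.sum_sum_type]
  have h1 := aux_block1 hn T hT l hl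
  have h2 := aux_block2 T hT l hl
  have h3 := aux_block3 T hT l hl
  have h1' : ∀ p : I1 n, u11 p.1.1 p.1.2 T l = u11 T l p.1.1 p.1.2 := by
    intro p
    unfold u11
    rw [Finset.inter_comm]
    simp only [iv, eq_comm]
  simp only [matU, Matrix.of_apply, h1']
  rw [h1, h2, h3]
  ring
end
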